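/- Let n ≥ k ≥ t−1 ≥ 1 and let 𝓕 ⊆ C([n],k) ∪ C([n],k−1) ∪ … ∪ C([n],k−t+1) be an s-extremal set system (all members have cardinality in {k−t+1, …, k}). Then the VC-dimension of 𝓕 is at most t−1. -/

import Mathlib

open Finset

/-- The family of subsets of `[n]` (identified with `Fin n`) shattered by the
set system `F ⊆ 2^[n]`. -/
def Sh (n : ℕ) (F : Finset (Finset (Fin n))) : Finset (Finset (Fin n)) :=
  Finset.univ.filter (fun S => ∀ H ∈ S.powerset, ∃ A ∈ F, A ∩ S = H)

/-- A set system is shattering-extremal (s-extremal) if it shatters exactly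
`|F|` sets. -/
def SExtremal (n : ℕ) (F : Finset (Finset (Fin n))) : Prop :=
  (Sh n F).card = F.card

/-- The inclusion graph of a set system: vertices are the members of `F`,
two sets adjacent iff their symmetric difference is a single element. -/
def inclGraph (n : ℕ) (F : Finset (Finset (Fin n))) : SimpleGraph {A // A ∈ F} where
  Adj A B := (symmDiff A.1 B.1).card = 1
  symm := by constructor; intro A B h; rwa [symmDiff_comm]
  loopless := by constructor; intro A h; simp [symmDiff_self] at h

/-- `F` strongly shatters `S` if it contains a full subcube with coordinate set `S`. -/
def StronglyShatters {α : Type*} [DecidableEq α] (F : Finset (Finset α)) (S : Finset α) : Prop :=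
  ∃ B, Disjoint B S ∧ ∀ H ⊆ S, B ∪ H ∈ F

section Splitting

variable {α : Type*} [DecidableEq α]

/-- Splitting `F` at `x` yields a subfamily of `F.shatterer` as large as the shatterers of the two
halves together, each member of which avoids `x` only if one of the halves shatters it. -/
lemma exists_subset_shatterer_card_eq (F : Finset (Finset α)) (x : α) :
    ∃ U ⊆ F.shatterer,
      #U = #(F.filter (x ∉ ·)).shatterer + #(F.filter (x ∈ ·)).shatterer ∧
      ∀ S ∈ U, x ∉ S → (F.filter (x ∉ ·)).Shatters S ∨ (F.filter (x ∈ ·)).Shatters S := by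
  set P := F.filter (x ∉ ·) with hP
  set Q := F.filter (x ∈ ·) with hQ
  have hPx : ∀ S, P.Shatters S → x ∉ S := by
    intro S hS hx
    obtain ⟨A, hA, hSA⟩ := hS.exists_superset
    exact (mem_filter.1 hA).2 (hSA hx)
  have hQx : ∀ S, Q.Shatters S → x ∉ S := by
    intro S hS hx
    obtain ⟨A, hA, hSA⟩ := hS (empty_subset S)
    have : x ∈ S ∩ A := mem_inter.2 ⟨hx, (mem_filter.1 hA).2⟩
    simp [hSA] at this
  have hdisj : Disjoint (P.shatterer ∪ Q.shatterer)
      ((P.shatterer ∩ Q.shatterer).image (insert x)) := by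
    rw [disjoint_left]
    intro S hS hS'
    obtain ⟨T, -, rfl⟩ := mem_image.1 hS'
    rcases mem_union.1 hS with h | h
    · exact hPx _ (mem_shatterer.1 h) (mem_insert_self _ _)
    · exact hQx _ (mem_shatterer.1 h) (mem_insert_self _ _)
  have hinj : Set.InjOn (insert x) ((P.shatterer ∩ Q.shatterer : Finset (Finset α)) :
      Set (Finset α)) := by
    intro S hS T hT h
    have hS' := hPx S (mem_shatterer.1 (mem_inter.1 hS).1)
    have hT' := hPx T (mem_shatterer.1 (mem_inter.1 hT).1)
    rw [← erase_insert hS', ← erase_insert hT', h]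
  refine ⟨P.shatterer ∪ Q.shatterer ∪ (P.shatterer ∩ Q.shatterer).image (insert x), ?_, ?_, ?_⟩
  · refine union_subset (union_subset (shatterer_mono (filter_subset _ _))
      (shatterer_mono (filter_subset _ _))) ?_
    intro S' hS'
    obtain ⟨S, hS, rfl⟩ := mem_image.1 hS'
    obtain ⟨hSP, hSQ⟩ := mem_inter.1 hS
    rw [mem_shatterer] at hSP hSQ ⊢
    have hxS := hPx S hSP
    intro H hH
    have hsub : H.erase x ⊆ S := fun y hy ↦
      (mem_insert.1 (hH (mem_of_mem_erase hy))).resolve_left (ne_of_mem_erase hy)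
    by_cases hxH : x ∈ H
    · obtain ⟨A, hA, hSA⟩ := hSQ hsub
      refine ⟨A, (mem_filter.1 hA).1, ?_⟩
      rw [insert_inter_of_mem (mem_filter.1 hA).2, hSA, insert_erase hxH]
    · obtain ⟨A, hA, hSA⟩ := hSP hsub
      refine ⟨A, (mem_filter.1 hA).1, ?_⟩
      rw [insert_inter_of_notMem (mem_filter.1 hA).2, hSA, erase_eq_of_notMem hxH]
  · rw [card_union_of_disjoint hdisj, card_image_of_injOn hinj, card_union_add_card_inter]
  · intro S hS hx
    rcases mem_union.1 hS with h | h
    · simpa using h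
    · obtain ⟨T, -, rfl⟩ := mem_image.1 h
      exact absurd (mem_insert_self _ _) hx

/-- Shattering-extremal families strongly shatter every set they shatter. -/
theorem Finset.Shatters.stronglyShatters {F : Finset (Finset α)} {S : Finset α}
    (hS : F.Shatters S) (hF : #F.shatterer = #F) : StronglyShatters F S := by
  induction hm : #F using Nat.strong_induction_on generalizing F with
  | _ m ih =>
    by_cases hsplit : ∃ x ∉ S, (∃ A ∈ F, x ∉ A) ∧ ∃ A ∈ F, x ∈ A
    · obtain ⟨x, hxS, ⟨A, hA, hxA⟩, ⟨A', hA', hxA'⟩⟩ := hsplit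
      obtain ⟨U, hUF, hU, hUS⟩ := exists_subset_shatterer_card_eq F x
      have hcard : #(F.filter (x ∈ ·)) + #(F.filter (x ∉ ·)) = #F :=
        card_filter_add_card_filter_not _
      have hP := card_le_card_shatterer (F.filter (x ∉ ·))
      have hQ := card_le_card_shatterer (F.filter (x ∈ ·))
      have hle := card_le_card hUF
      have hUeq : U = F.shatterer := eq_of_subset_of_card_le hUF (by omega)
      have hP0 : 0 < #(F.filter (x ∉ ·)) := card_pos.2 ⟨A, mem_filter.2 ⟨hA, hxA⟩⟩
      have hQ0 : 0 < #(F.filter (x ∈ ·)) := card_pos.2 ⟨A', mem_filter.2 ⟨hA', hxA'⟩⟩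
      rcases hUS S (by rw [hUeq]; exact mem_shatterer.2 hS) hxS with h | h
      · obtain ⟨B, hB, hBH⟩ := ih _ (by omega) h (by omega) rfl
        exact ⟨B, hB, fun H hH ↦ (mem_filter.1 (hBH H hH)).1⟩
      · obtain ⟨B, hB, hBH⟩ := ih _ (by omega) h (by omega) rfl
        exact ⟨B, hB, fun H hH ↦ (mem_filter.1 (hBH H hH)).1⟩
    · push Not at hsplit
      obtain ⟨C, hC⟩ := hS.nonempty
      refine ⟨C \ S, sdiff_disjoint, fun H hH ↦ ?_⟩
      obtain ⟨A, hA, hSA⟩ := hS hH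
      convert hA using 1
      ext y
      rw [← hSA]
      by_cases hy : y ∈ S
      · simp [hy]
      · have h₁ := hsplit y hy
        simp only [mem_union, mem_sdiff, mem_inter, hy, not_false_eq_true, and_true, false_and,
          or_false]
        exact ⟨fun h ↦ by_contra fun h' ↦ h₁ ⟨A, hA, h'⟩ C hC h,
          fun h ↦ by_contra fun h' ↦ h₁ ⟨C, hC, h'⟩ A hA h⟩

end Splitting

lemma Sh_eq_shatterer (n : ℕ) (F : Finset (Finset (Fin n))) : Sh n F = F.shatterer := by
  ext S
  simp [Sh, Finset.Shatters, inter_comm]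

/-- An s-extremal set system contained in `t` consecutive layers
`C([n],k) ∪ ⋯ ∪ C([n],k-t+1)` has VC-dimension at most `t - 1`. -/
theorem stmt5 (n k t : ℕ) (ht : 2 ≤ t) (hkt : t - 1 ≤ k) (hkn : k ≤ n)
    (F : Finset (Finset (Fin n)))
    (hlayers : ∀ A ∈ F, k - t + 1 ≤ A.card ∧ A.card ≤ k)
    (hext : SExtremal n F) :
    ∀ S ∈ Sh n F, S.card ≤ t - 1 := by
  intro S hS
  rw [Sh_eq_shatterer, mem_shatterer] at hS
  rw [SExtremal, Sh_eq_shatterer] at hext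
  obtain ⟨B, hB, hBH⟩ := hS.stronglyShatters hext
  have hbot := (hlayers _ (hBH ∅ (empty_subset S))).1
  have htop := (hlayers _ (hBH S subset_rfl)).2
  rw [union_empty] at hbot
  rw [card_union_of_disjoint hB] at htop
  omega
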